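/- For every odd integer γ ≥ 3 there exists a set S of 2γ+1 distinct points of the Euclidean plane ℝ², each labeled red or blue, such that: (a) there exist two oppositely-labeled points p, q ∈ S and weights w_p, w_q > 0 for which the pair ({p,q}, w) is WNN-consistent with S; and (b) every subset T ⊆ S that is NN-consistent with S has cardinality at least 2γ − 1. -/

import Mathlib

noncomputable section
open Classical

/-- The Euclidean plane. -/
abbrev Pt := EuclideanSpace ℝ (Fin 2)

/-- `T` is NN-consistent with `S` (labels given by `l`): every `p ∈ S` has a
same-labeled `q ∈ T` at distance not larger than that of every oppositely-labeled
point of `T`. -/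
def NNConsistent (l : Pt → Bool) (S T : Finset Pt) : Prop :=
  ∀ p ∈ S, ∃ q ∈ T, l q = l p ∧ ∀ q' ∈ T, l q' ≠ l p → dist p q ≤ dist p q'

/-- `(T, w)` is WNN-consistent with `S`: every `p ∈ S` has a same-labeled `q ∈ T`
whose weighted distance is strictly smaller than that of every oppositely-labeled
point of `T`. -/
def WNNConsistent (l : Pt → Bool) (S T : Finset Pt) (w : Pt → ℝ) : Prop :=
  ∀ p ∈ S, ∃ q ∈ T, l q = l p ∧ ∀ q' ∈ T, l q' ≠ l p →
    dist p q / w q < dist p q' / w q'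

/-- The distance in the plane in coordinates. -/
theorem Pt.dist_eq_sqrt (p q : Pt) :
    dist p q = Real.sqrt ((p 0 - q 0) ^ 2 + (p 1 - q 1) ^ 2) := by
  simp [EuclideanSpace.dist_eq, Real.dist_eq, Fin.sum_univ_two, sq_abs]

theorem Pt.dist_sq (p q : Pt) : dist p q ^ 2 = (p 0 - q 0) ^ 2 + (p 1 - q 1) ^ 2 := by
  rw [Pt.dist_eq_sqrt, Real.sq_sqrt (by positivity)]

/-- Points are labeled `true` exactly when they lie outside the circle of radius `2 * B`
centred at the origin. -/
def circleLabel (B : ℝ) (v : Pt) : Bool := decide ((2 * B) ^ 2 < v 0 ^ 2 + v 1 ^ 2)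

/-- The inner one of two points that are inverse with respect to the circle of radius `2 * B`. -/
def innerPt (B : ℝ) : Pt := !₂[0, B]

/-- The outer one of two points that are inverse with respect to the circle of radius `2 * B`. -/
def outerPt (B : ℝ) : Pt := !₂[0, 4 * B]

/-- A sequence of points that zigzags across the circle of radius `2 * B` near its lowest point. -/
def zigzagPt (B : ℝ) (k : ℕ) : Pt := !₂[(k : ℝ), if Odd k then -(2 * B) else -(2 * B) + 1]

@[simp] theorem innerPt_zero (B : ℝ) : innerPt B 0 = 0 := rfl
@[simp] theorem innerPt_one (B : ℝ) : innerPt B 1 = B := rfl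
@[simp] theorem outerPt_zero (B : ℝ) : outerPt B 0 = 0 := rfl
@[simp] theorem outerPt_one (B : ℝ) : outerPt B 1 = 4 * B := rfl
@[simp] theorem zigzagPt_zero (B : ℝ) (k : ℕ) : zigzagPt B k 0 = k := rfl
theorem zigzagPt_one (B : ℝ) (k : ℕ) :
    zigzagPt B k 1 = if Odd k then -(2 * B) else -(2 * B) + 1 := rfl

theorem zigzagPt_injective (B : ℝ) : Function.Injective (zigzagPt B) := fun i j h => by
  have := congrArg (fun v : Pt => v 0) h
  simpa using this

theorem zigzagPt_one_le {B : ℝ} (k : ℕ) : zigzagPt B k 1 ≤ -(2 * B) + 1 := by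
  rw [zigzagPt_one]; split_ifs <;> linarith

theorem circleLabel_innerPt (B : ℝ) : circleLabel B (innerPt B) = false := by
  rw [circleLabel, decide_eq_false_iff_not, not_lt, innerPt_zero, innerPt_one]
  nlinarith

theorem circleLabel_outerPt {B : ℝ} (hB : 0 < B) : circleLabel B (outerPt B) = true := by
  rw [circleLabel, decide_eq_true_eq, outerPt_zero, outerPt_one]
  nlinarith

theorem circleLabel_zigzagPt {B : ℝ} {k : ℕ} (hk : 1 ≤ k) (hkB : (k : ℝ) ^ 2 + 1 < 4 * B) :
    circleLabel B (zigzagPt B k) = decide (Odd k) := by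
  have hk' : (1 : ℝ) ≤ k := by exact_mod_cast hk
  unfold circleLabel
  rw [decide_eq_decide, zigzagPt_zero, zigzagPt_one]
  split_ifs with h
  · simp only [h, iff_true]; nlinarith
  · simp only [h, iff_false, not_lt]; nlinarith

theorem norm_sq_zigzagPt_ne {B : ℝ} {k : ℕ} (hk : 1 ≤ k) (hkB : (k : ℝ) ^ 2 + 1 < 4 * B) :
    zigzagPt B k 0 ^ 2 + zigzagPt B k 1 ^ 2 ≠ (2 * B) ^ 2 := by
  have hk' : (1 : ℝ) ≤ k := by exact_mod_cast hk
  rw [zigzagPt_zero, zigzagPt_one]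
  split_ifs with h
  · exact ne_of_gt (by nlinarith)
  · exact ne_of_lt (by nlinarith)

/-- The circle of radius `2 * B` is an Apollonius circle of `innerPt B` and `outerPt B`. -/
theorem dist_sq_outerPt_sub (B : ℝ) (v : Pt) :
    dist v (outerPt B) ^ 2 - (2 * dist v (innerPt B)) ^ 2 =
      3 * ((2 * B) ^ 2 - (v 0 ^ 2 + v 1 ^ 2)) := by
  rw [mul_pow, Pt.dist_sq, Pt.dist_sq]
  simp only [innerPt_zero, innerPt_one, outerPt_zero, outerPt_one]
  ring

theorem dist_outerPt_lt_iff (B : ℝ) (v : Pt) :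
    dist v (outerPt B) < 2 * dist v (innerPt B) ↔ (2 * B) ^ 2 < v 0 ^ 2 + v 1 ^ 2 := by
  rw [← sq_lt_sq₀ (by positivity) (by positivity)]
  have := dist_sq_outerPt_sub B v
  constructor <;> intro h <;> linarith

theorem lt_dist_outerPt_iff (B : ℝ) (v : Pt) :
    2 * dist v (innerPt B) < dist v (outerPt B) ↔ v 0 ^ 2 + v 1 ^ 2 < (2 * B) ^ 2 := by
  rw [← sq_lt_sq₀ (by positivity) (by positivity)]
  have := dist_sq_outerPt_sub B v
  constructor <;> intro h <;> linarith

/-- The two poles of an Apollonius circle, suitably weighted, classify every point off the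
circle correctly. -/
theorem wnnConsistent_poles {B : ℝ} (hB : 0 < B) {S : Finset Pt}
    (hS : ∀ v ∈ S, v 0 ^ 2 + v 1 ^ 2 ≠ (2 * B) ^ 2) :
    WNNConsistent (circleLabel B) S {outerPt B, innerPt B}
      (fun v => if circleLabel B v then 2 else 1) := by
  have hi := circleLabel_innerPt B
  have ho := circleLabel_outerPt hB
  intro v hv
  rcases lt_or_gt_of_ne (hS v hv) with h | h
  · have hl : circleLabel B v = false := by
      simp only [circleLabel, decide_eq_false_iff_not, not_lt]; exact h.le
    refine ⟨innerPt B, by simp, by rw [hi, hl], fun q hq hql => ?_⟩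
    rcases Finset.mem_insert.1 hq with rfl | hq
    · have := (lt_dist_outerPt_iff B v).2 h
      simp only [hi, ho, if_true, Bool.false_eq_true, if_false]
      linarith
    · rw [Finset.mem_singleton.1 hq, hi, hl] at hql
      exact absurd rfl hql
  · have hl : circleLabel B v = true := by
      simp only [circleLabel, decide_eq_true_eq]; exact h
    refine ⟨outerPt B, by simp, by rw [ho, hl], fun q hq hql => ?_⟩
    rcases Finset.mem_insert.1 hq with rfl | hq
    · rw [ho, hl] at hql
      exact absurd rfl hql
    · rw [Finset.mem_singleton.1 hq]
      have := (dist_outerPt_lt_iff B v).2 h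
      simp only [hi, ho, if_true, Bool.false_eq_true, if_false]
      linarith

/-- The two poles together with the first `n` points of the zigzag. -/
def zigzagSet (B : ℝ) (n : ℕ) : Finset Pt :=
  insert (outerPt B) (insert (innerPt B) ((Finset.Icc 1 n).image (zigzagPt B)))

theorem mem_zigzagSet {B : ℝ} {n : ℕ} {v : Pt} :
    v ∈ zigzagSet B n ↔
      v = outerPt B ∨ v = innerPt B ∨ ∃ k, (1 ≤ k ∧ k ≤ n) ∧ zigzagPt B k = v := by
  simp [zigzagSet]

theorem card_zigzagSet {B : ℝ} (hB : 1 ≤ B) (n : ℕ) : (zigzagSet B n).card = n + 2 := by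
  have hout (k : ℕ) : zigzagPt B k ≠ outerPt B := fun h => by
    have h1 : zigzagPt B k 1 = 4 * B := by rw [h, outerPt_one]
    linarith [zigzagPt_one_le (B := B) k]
  have hin (k : ℕ) : zigzagPt B k ≠ innerPt B := fun h => by
    have h1 : zigzagPt B k 1 = B := by rw [h, innerPt_one]
    linarith [zigzagPt_one_le (B := B) k]
  have hne : outerPt B ≠ innerPt B := fun h => by
    have h1 : outerPt B 1 = B := by rw [h, innerPt_one]
    rw [outerPt_one] at h1
    linarith
  rw [zigzagSet, Finset.card_insert_of_notMem, Finset.card_insert_of_notMem,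
    Finset.card_image_of_injective _ (zigzagPt_injective B), Nat.card_Icc]
  · lia
  · simp only [Finset.mem_image, not_exists, not_and]
    exact fun k _ => hin k
  · simp only [Finset.mem_insert, Finset.mem_image, not_or, not_exists, not_and]
    exact ⟨hne, fun k _ => hout k⟩

theorem dist_sq_zigzagPt_succ (B : ℝ) (i j : ℕ) (h : i = j + 1 ∨ j = i + 1) :
    dist (zigzagPt B i) (zigzagPt B j) ^ 2 = 2 := by
  rw [Pt.dist_sq, zigzagPt_zero, zigzagPt_zero, zigzagPt_one, zigzagPt_one]
  rcases h with rfl | rfl <;> simp only [Nat.odd_add_one] <;> split_ifs <;>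
    first | contradiction | (push_cast; ring)

theorem two_lt_dist_sq_zigzagPt (B : ℝ) {i j : ℕ} (hij : i ≠ j) (hp : Odd i ↔ Odd j) :
    2 < dist (zigzagPt B i) (zigzagPt B j) ^ 2 := by
  have h2 : i + 2 ≤ j ∨ j + 2 ≤ i := by
    rw [Nat.odd_iff, Nat.odd_iff] at hp
    lia
  rw [Pt.dist_sq, zigzagPt_zero, zigzagPt_zero]
  rcases h2 with h | h
  · have : (i : ℝ) + 2 ≤ j := by exact_mod_cast h
    nlinarith [sq_nonneg (zigzagPt B i 1 - zigzagPt B j 1)]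
  · have : (j : ℝ) + 2 ≤ i := by exact_mod_cast h
    nlinarith [sq_nonneg (zigzagPt B i 1 - zigzagPt B j 1)]

theorem two_lt_dist_sq_of_le_one {B : ℝ} (hB : 1 ≤ B) (k : ℕ) {q : Pt} (hq : B ≤ q 1) :
    2 < dist (zigzagPt B k) q ^ 2 := by
  rw [Pt.dist_sq]
  have h := zigzagPt_one_le (B := B) k
  nlinarith [sq_nonneg (zigzagPt B k 0 - q 0)]

/-- In a consistent subset, the neighbour on the zigzag of a chosen point is chosen too. -/
theorem zigzagPt_mem_of_neighbour_mem {B : ℝ} (hB : 1 ≤ B) {n : ℕ}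
    (hn : (n : ℝ) ^ 2 + 1 < 4 * B) {T : Finset Pt} (hT : T ⊆ zigzagSet B n)
    (hc : NNConsistent (circleLabel B) (zigzagSet B n) T) {i j : ℕ}
    (hi : 1 ≤ i ∧ i ≤ n) (hj : 1 ≤ j ∧ j ≤ n) (hij : i = j + 1 ∨ j = i + 1)
    (hjT : zigzagPt B j ∈ T) : zigzagPt B i ∈ T := by
  have hlab {k : ℕ} (hk : 1 ≤ k ∧ k ≤ n) : circleLabel B (zigzagPt B k) = decide (Odd k) := by
    refine circleLabel_zigzagPt hk.1 (lt_of_le_of_lt ?_ hn)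
    have : (k : ℝ) ≤ n := by exact_mod_cast hk.2
    gcongr
  obtain ⟨q, hqT, hql, hq⟩ := hc (zigzagPt B i) (mem_zigzagSet.2 (.inr (.inr ⟨i, hi, rfl⟩)))
  have hd := hq _ hjT (by
    rw [hlab hi, hlab hj, Ne, decide_eq_decide]
    rcases hij with rfl | rfl <;> rw [Nat.odd_add_one] <;> tauto)
  have hd2 : dist (zigzagPt B i) q ^ 2 ≤ 2 := by
    rw [← dist_sq_zigzagPt_succ B i j hij]
    gcongr
  rcases mem_zigzagSet.1 (hT hqT) with rfl | rfl | ⟨k, hk, rfl⟩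
  · have := two_lt_dist_sq_of_le_one hB i (q := outerPt B) (by rw [outerPt_one]; linarith)
    linarith
  · have := two_lt_dist_sq_of_le_one hB i (q := innerPt B) (by rw [innerPt_one])
    linarith
  · by_cases hik : i = k
    · rwa [hik]
    · rw [hlab hk, hlab hi, decide_eq_decide] at hql
      linarith [two_lt_dist_sq_zigzagPt B hik hql.symm]

/-- The two poles alone are not consistent, so a consistent subset meets the zigzag. -/
theorem exists_zigzagPt_mem {B : ℝ} (hB : 1 ≤ B) {n : ℕ} (hn1 : 1 ≤ n)
    {T : Finset Pt} (hT : T ⊆ zigzagSet B n)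
    (hc : NNConsistent (circleLabel B) (zigzagSet B n) T) :
    ∃ k, (1 ≤ k ∧ k ≤ n) ∧ zigzagPt B k ∈ T := by
  by_contra! hnone
  have hi := circleLabel_innerPt B
  have ho := circleLabel_outerPt (B := B) (by linarith)
  have hpoles {q : Pt} (hq : q ∈ T) : q = outerPt B ∨ q = innerPt B := by
    rcases mem_zigzagSet.1 (hT hq) with h | h | ⟨k, hk, rfl⟩
    · exact .inl h
    · exact .inr h
    · exact absurd hq (hnone k hk)
  have hone : circleLabel B (zigzagPt B 1) = true := by
    rw [circleLabel_zigzagPt le_rfl (by push_cast; linarith)]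
    simp
  have hinT : innerPt B ∈ T := by
    obtain ⟨q, hqT, hql, -⟩ := hc (innerPt B) (mem_zigzagSet.2 (.inr (.inl rfl)))
    rcases hpoles hqT with rfl | rfl
    · simp [ho, hi] at hql
    · exact hqT
  obtain ⟨q, hqT, hql, hq⟩ :=
    hc (zigzagPt B 1) (mem_zigzagSet.2 (.inr (.inr ⟨1, ⟨le_rfl, hn1⟩, rfl⟩)))
  rcases hpoles hqT with rfl | rfl
  · have hd := hq _ hinT (by simp [hi, hone])
    rw [← sq_le_sq₀ (by positivity) (by positivity), Pt.dist_sq, Pt.dist_sq] at hd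
    simp only [innerPt_zero, innerPt_one, outerPt_zero, outerPt_one] at hd
    nlinarith [zigzagPt_one_le (B := B) 1]
  · simp [hone, hi] at hql

/-- A consistent subset contains the whole zigzag. -/
theorem le_card_of_nnConsistent {B : ℝ} (hB : 1 ≤ B) {n : ℕ} (hn1 : 1 ≤ n)
    (hn : (n : ℝ) ^ 2 + 1 < 4 * B) {T : Finset Pt} (hT : T ⊆ zigzagSet B n)
    (hc : NNConsistent (circleLabel B) (zigzagSet B n) T) : n ≤ T.card := by
  obtain ⟨k, hk, hkT⟩ := exists_zigzagPt_mem hB hn1 hT hc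
  have hup (j : ℕ) (hkj : k ≤ j) : j ≤ n → zigzagPt B j ∈ T := by
    induction j, hkj using Nat.le_induction with
    | base => exact fun _ => hkT
    | succ j hkj ih =>
      exact fun hj => zigzagPt_mem_of_neighbour_mem hB hn hT hc (by lia) (by lia) (.inl rfl)
        (ih (by lia))
  have hdown (j : ℕ) (hjk : j ≤ k) : 1 ≤ j → zigzagPt B j ∈ T := by
    induction hjk using Nat.decreasingInduction with
    | self => exact fun _ => hkT
    | of_succ j hjk ih =>
      exact fun hj => zigzagPt_mem_of_neighbour_mem hB hn hT hc (by lia) (by lia) (.inr rfl)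
        (ih (by lia))
  have hsub : (Finset.Icc 1 n).image (zigzagPt B) ⊆ T := by
    intro v hv
    obtain ⟨j, hj, rfl⟩ := Finset.mem_image.1 hv
    rw [Finset.mem_Icc] at hj
    rcases le_total k j with h | h
    · exact hup j h hj.2
    · exact hdown j h hj.1
  calc n = ((Finset.Icc 1 n).image (zigzagPt B)).card := by
        rw [Finset.card_image_of_injective _ (zigzagPt_injective B), Nat.card_Icc]; lia
    _ ≤ T.card := Finset.card_le_card hsub

/-- For every odd `γ ≥ 3` there is a set of `2γ+1` distinct labeled points of the
plane that condenses to two weighted points under the WNN rule, while every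
NN-consistent subset has at least `2γ-1` points. -/
theorem stmt0 (γ : ℕ) (hodd : Odd γ) (hγ : 3 ≤ γ) :
    ∃ (S : Finset Pt) (l : Pt → Bool),
      S.card = 2 * γ + 1 ∧
      (∃ p ∈ S, ∃ q ∈ S, l p ≠ l q ∧
        ∃ w : Pt → ℝ, 0 < w p ∧ 0 < w q ∧ WNNConsistent l S {p, q} w) ∧
      (∀ T ⊆ S, NNConsistent l S T → 2 * γ - 1 ≤ T.card) := by
  have hγ' : (3 : ℝ) ≤ γ := by exact_mod_cast hγ
  obtain ⟨n, hn⟩ : ∃ n, 2 * γ = n + 1 := ⟨2 * γ - 1, by lia⟩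
  have hnγ : (n : ℝ) = 2 * γ - 1 := by
    have : (2 * γ : ℝ) = n + 1 := by exact_mod_cast hn
    linarith
  set B : ℝ := (γ : ℝ) ^ 2 with hBdef
  have hB : 1 ≤ B := by nlinarith
  have hnB : (n : ℝ) ^ 2 + 1 < 4 * B := by rw [hnγ]; nlinarith
  have hi := circleLabel_innerPt B
  have ho := circleLabel_outerPt (B := B) (by linarith)
  refine ⟨zigzagSet B n, circleLabel B, by rw [card_zigzagSet hB]; lia,
    ⟨outerPt B, mem_zigzagSet.2 (.inl rfl), innerPt B, mem_zigzagSet.2 (.inr (.inl rfl)),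
      by simp [hi, ho], fun v => if circleLabel B v then 2 else 1, by simp [ho], by simp [hi],
      wnnConsistent_poles (by linarith) fun v hv => ?_⟩,
    fun T hT hc => ?_⟩
  · rcases mem_zigzagSet.1 hv with rfl | rfl | ⟨k, hk, rfl⟩
    · rw [outerPt_zero, outerPt_one]
      exact ne_of_gt (by nlinarith)
    · rw [innerPt_zero, innerPt_one]
      exact ne_of_lt (by nlinarith)
    · refine norm_sq_zigzagPt_ne hk.1 (lt_of_le_of_lt ?_ hnB)
      have : (k : ℝ) ≤ n := by exact_mod_cast hk.2
      gcongr
  · have := le_card_of_nnConsistent hB (by lia) hnB hT hc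
    lia
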